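/- arXiv:1601.06361 — 4 statements merged into one kernel-verified Lean document; each statement's English description precedes it below -/
import Mathlib

section
/- Let p be a prime and let H be a subgroup of G = GL₂(𝔽_p) that is not commutative. Then the centralizer of H in G equals the center of G, i.e. every matrix of G commuting with all elements of H is a scalar matrix. -/
lemma comm_entries {F : Type*} [Field F] (g x : Matrix (Fin 2) (Fin 2) F) :
    g * x = x * g ↔ (g 0 1 * x 1 0 = g 1 0 * x 0 1 ∧
      g 0 1 * (x 0 0 - x 1 1) = (g 0 0 - g 1 1) * x 0 1 ∧
      g 1 0 * (x 0 0 - x 1 1) = (g 0 0 - g 1 1) * x 1 0) := by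
  rw [← Matrix.ext_iff]
  simp only [Fin.forall_fin_two, Matrix.mul_apply, Fin.sum_univ_two]
  constructor
  · rintro ⟨⟨h1, h2⟩, h3, h4⟩
    refine ⟨?_, ?_, ?_⟩
    · linear_combination h1
    · linear_combination -h2
    · linear_combination h3
  · rintro ⟨h1, h2, h3⟩
    refine ⟨⟨?_, ?_⟩, ?_, ?_⟩
    · linear_combination h1
    · linear_combination -h2
    · linear_combination h3
    · linear_combination -h1

lemma parallel_aux {F : Type*} [Field F] {a b c x y z u v w : F}
    (h1 : a * y = b * x) (h2 : a * z = c * x)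
    (k1 : a * v = b * u) (k2 : a * w = c * u) (ha : a ≠ 0) :
    x * v = y * u ∧ x * w = z * u ∧ y * w = z * v := by
  have hy : y = b * x / a := by field_simp; linear_combination h1
  have hz : z = c * x / a := by field_simp; linear_combination h2
  have hv : v = b * u / a := by field_simp; linear_combination k1
  have hw : w = c * u / a := by field_simp; linear_combination k2
  subst hy hz hv hw
  refine ⟨?_, ?_, ?_⟩ <;> ring

lemma comm_of_comm {F : Type*} [Field F] (g x y : Matrix (Fin 2) (Fin 2) F)
    (hx : g * x = x * g) (hy : g * y = y * g) (hxy : x * y ≠ y * x) :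
    g 0 1 = 0 ∧ g 1 0 = 0 ∧ g 0 0 - g 1 1 = 0 := by
  rw [comm_entries] at hx hy
  rw [Ne, comm_entries] at hxy
  obtain ⟨h1, h2, h3⟩ := hx
  obtain ⟨k1, k2, k3⟩ := hy
  refine ⟨?_, ?_, ?_⟩ <;> by_contra ha <;> apply hxy
  · obtain ⟨e1, e2, e3⟩ := parallel_aux h1 h2 k1 k2 ha
    exact ⟨e1, e2, e3⟩
  · obtain ⟨e1, e2, e3⟩ := parallel_aux h1.symm h3 k1.symm k3 ha
    exact ⟨e1.symm, e3, e2⟩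
  · obtain ⟨e1, e2, e3⟩ := parallel_aux h2.symm h3.symm k2.symm k3.symm ha
    exact ⟨e3, e1.symm, e2.symm⟩


/-- **Lemme A.3 of [HK2002].** If `H` is a non-commutative subgroup of `G = GL₂(𝔽_p)`,
then the centralizer of `H` in `G` equals the center of `G`. -/
theorem centralizer_eq_center_of_nonabelian
    (p : ℕ) (hp : p.Prime)
    (H : Subgroup (Matrix.GeneralLinearGroup (Fin 2) (ZMod p)))
    (hnab : ¬ ∀ x ∈ H, ∀ y ∈ H, x * y = y * x) :
    Subgroup.centralizer (H : Set (Matrix.GeneralLinearGroup (Fin 2) (ZMod p))) =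
      Subgroup.center (Matrix.GeneralLinearGroup (Fin 2) (ZMod p)) := by
  haveI : Fact p.Prime := ⟨hp⟩
  apply le_antisymm
  · intro g hg
    rw [Subgroup.mem_centralizer_iff] at hg
    rw [Subgroup.mem_center_iff]
    push Not at hnab
    obtain ⟨x, hx, y, hy, hxy⟩ := hnab
    have hgx := congrArg Units.val (hg x hx)
    have hgy := congrArg Units.val (hg y hy)
    have hxy' : x.val * y.val ≠ y.val * x.val := fun h => hxy (Units.ext h)
    obtain ⟨h1, h2, h3⟩ := comm_of_comm g.val x.val y.val hgx.symm hgy.symm hxy'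
    intro z
    apply Units.ext
    refine ((comm_entries g.val z.val).2 ?_).symm
    rw [h1, h2, h3]
    simp
  · exact Subgroup.center_le_centralizer _
end

section
/- Let p be a prime, let Γ be a group, and let ρ, ρ′ : Γ → GL₂(𝔽_p) be group homomorphisms such that the image of ρ is not commutative. Suppose M, N ∈ GL₂(𝔽_p) satisfy ρ′(g) = M·ρ(g)·M⁻¹ and ρ′(g) = N·ρ(g)·N⁻¹ for all g ∈ Γ. Then det(M)·det(N)⁻¹ is a square in 𝔽_p^×; in particular det(M) and det(N) lie in the same square class modulo p. -/
/-- A 2×2 matrix over a field commuting with two non-commuting matrices has square determinant. -/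
theorem det_eq_sq_of_commutes {F : Type*} [Field F] (A B C : Matrix (Fin 2) (Fin 2) F)
    (hA : C * A = A * C) (hB : C * B = B * C) (hAB : A * B ≠ B * A) :
    C.det = C 0 0 * C 0 0 := by
  have key : C 0 1 = 0 ∧ C 1 0 = 0 ∧ C 0 0 = C 1 1 := by
    have a1 := congrFun (congrFun hA 0) 0
    have a2 := congrFun (congrFun hA 0) 1
    have a3 := congrFun (congrFun hA 1) 0
    have b1 := congrFun (congrFun hB 0) 0
    have b2 := congrFun (congrFun hB 0) 1
    have b3 := congrFun (congrFun hB 1) 0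
    simp only [Matrix.mul_apply, Fin.sum_univ_two] at a1 a2 a3 b1 b2 b3
    have hz : ∀ x : F, (x * (A 0 1 * B 1 0 - A 1 0 * B 0 1) = 0) →
        (x * ((A 0 0 - A 1 1) * B 0 1 - A 0 1 * (B 0 0 - B 1 1)) = 0) →
        (x * ((A 0 0 - A 1 1) * B 1 0 - A 1 0 * (B 0 0 - B 1 1)) = 0) → x = 0 := by
      intro x h1 h2 h3
      by_contra hx
      have h1 := (mul_eq_zero.mp h1).resolve_left hx
      have h2 := (mul_eq_zero.mp h2).resolve_left hx
      have h3 := (mul_eq_zero.mp h3).resolve_left hx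
      apply hAB
      ext i j
      fin_cases i <;> fin_cases j <;> simp [Matrix.mul_apply, Fin.sum_univ_two]
      · linear_combination h1
      · linear_combination h2
      · linear_combination -h3
      · linear_combination -h1
    refine ⟨hz _ ?_ ?_ ?_, hz _ ?_ ?_ ?_, sub_eq_zero.mp (hz _ ?_ ?_ ?_)⟩ <;> grind
  obtain ⟨h1, h2, h3⟩ := key
  rw [Matrix.det_fin_two, h1, ← h3]; ring

/-- Final statement of **Lemma 3.1**, reformulated: if `ρ, ρ'` are 2-dimensional
mod-`p` representations of a group `Γ` with `ρ` of non-abelian image, and `M`, `N`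
both conjugate `ρ` into `ρ'`, then `det M` and `det N` lie in the same square class
modulo `p`. -/
theorem det_same_square_class_of_conj
    (p : ℕ) (hp : p.Prime) (Γ : Type*) [Group Γ]
    (ρ ρ' : Γ →* Matrix.GeneralLinearGroup (Fin 2) (ZMod p))
    (hnab : ¬ ∀ g h : Γ, ρ g * ρ h = ρ h * ρ g)
    (M N : Matrix.GeneralLinearGroup (Fin 2) (ZMod p))
    (hM : ∀ g : Γ, ρ' g = M * ρ g * M⁻¹)
    (hN : ∀ g : Γ, ρ' g = N * ρ g * N⁻¹) :
    IsSquare (Matrix.GeneralLinearGroup.det M * (Matrix.GeneralLinearGroup.det N)⁻¹) := by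
  haveI : Fact p.Prime := ⟨hp⟩
  push Not at hnab
  obtain ⟨g, h, hgh⟩ := hnab
  have comm : ∀ g : Γ, (N⁻¹ * M) * ρ g = ρ g * (N⁻¹ * M) := by
    intro g
    have e : M * ρ g * M⁻¹ = N * ρ g * N⁻¹ := (hM g).symm.trans (hN g)
    calc (N⁻¹ * M) * ρ g = N⁻¹ * (M * ρ g * M⁻¹) * M := by group
      _ = ρ g * (N⁻¹ * M) := by rw [e]; group
  have hd := det_eq_sq_of_commutes (ρ g).val (ρ h).val (N⁻¹ * M).val
    (by simpa using congrArg Units.val (comm g)) (by simpa using congrArg Units.val (comm h))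
    (fun e => hgh (Units.ext e))
  have hval : ((Matrix.GeneralLinearGroup.det (N⁻¹ * M) : (ZMod p)ˣ) : ZMod p)
      = (N⁻¹ * M).val 0 0 * (N⁻¹ * M).val 0 0 := hd
  have hne : (N⁻¹ * M).val 0 0 ≠ 0 := by
    intro h0
    rw [h0, mul_zero] at hval
    exact (Matrix.GeneralLinearGroup.det (N⁻¹ * M)).ne_zero hval
  refine ⟨Units.mk0 _ hne, ?_⟩
  have e2 : Matrix.GeneralLinearGroup.det M * (Matrix.GeneralLinearGroup.det N)⁻¹
      = Matrix.GeneralLinearGroup.det (N⁻¹ * M) := by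
    rw [map_mul, map_inv, mul_comm]
  rw [e2]
  exact Units.ext hval
end

section
/- Let p be a prime and let a, b, c be nonzero integers with gcd(a, b) = 1, a³ + b³ = c^p, and 3 dividing c. Then the Weierstrass curve E_{a,b} : Y² = X³ + 3abX + (b³ − a³) satisfies v₃(c₄(E_{a,b})) = 2, v₃(c₆(E_{a,b})) = 3, and v₃(Δ(E_{a,b})) = 3 + 2·p·v₃(c). -/
lemma padicVal_three_pow_aux (c : ℤ) (hc : c ≠ 0) (n : ℕ) :
    padicValInt 3 (c ^ n) = n * padicValInt 3 c := by
  induction n with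
  | zero => simp
  | succ k ih =>
    rw [pow_succ, padicValInt.mul (pow_ne_zero _ hc) hc, ih]
    ring

lemma padicVal_three_aux (k : ℕ) (m : ℤ) (hm : ¬ (3 : ℤ) ∣ m) :
    padicValInt 3 (3 ^ k * m) = k := by
  have hm0 : m ≠ 0 := by
    rintro rfl
    simp at hm
  have hself : padicValInt 3 3 = 1 := padicValInt.self (by norm_num)
  rw [padicValInt.mul (by positivity) hm0, padicVal_three_pow_aux 3 (by norm_num),
    hself, padicValInt.eq_zero_of_not_dvd (by exact_mod_cast hm)]
  ring

/-- Part (3.1) of the proof of Lemma 4.1 in [Kraus1998]: for nonzero coprime `a, b`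
with `a³ + b³ = c^p` and `3 ∣ c`, the Frey curve `E_{a,b} : Y² = X³ + 3abX + (b³ − a³)`
has `v₃(c₄) = 2`, `v₃(c₆) = 3` and `v₃(Δ) = 3 + 2·p·v₃(c)`. -/
theorem frey_curve_three_adic_invariants
    (p : ℕ) (hp : p.Prime) (a b c : ℤ)
    (ha : a ≠ 0) (hb : b ≠ 0) (hc : c ≠ 0)
    (hab : Int.gcd a b = 1) (h : a ^ 3 + b ^ 3 = c ^ p) (h3 : (3 : ℤ) ∣ c) :
    padicValInt 3 (-48 * (3 * a * b)) = 2 ∧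
      padicValInt 3 (-864 * (b ^ 3 - a ^ 3)) = 3 ∧
      padicValInt 3 (-16 * (4 * (3 * a * b) ^ 3 + 27 * (b ^ 3 - a ^ 3) ^ 2)) =
        3 + 2 * p * padicValInt 3 c := by
  have hP : Prime (3 : ℤ) := Int.prime_three
  have h3c : (3 : ℤ) ∣ a ^ 3 + b ^ 3 := h ▸ dvd_pow h3 hp.ne_zero
  have h1 : ¬ (3 : ℤ) ∣ 1 := by norm_num
  have hna : ¬ (3 : ℤ) ∣ a := by
    intro hd
    have hb3 : (3 : ℤ) ∣ b :=
      hP.dvd_of_dvd_pow ((dvd_add_right (dvd_pow hd three_ne_zero)).1 h3c)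
    have := Int.dvd_coe_gcd hd hb3
    rw [hab] at this
    exact h1 (by exact_mod_cast this)
  have hnb : ¬ (3 : ℤ) ∣ b := by
    intro hd
    exact hna (hP.dvd_of_dvd_pow ((dvd_add_left (dvd_pow hd three_ne_zero)).1 h3c))
  have hnab : ¬ (3 : ℤ) ∣ -16 * (a * b) := by
    intro hd
    rcases hP.dvd_or_dvd hd with h' | h'
    · norm_num at h'
    · exact (hP.dvd_or_dvd h').elim hna hnb
  have hnd : ¬ (3 : ℤ) ∣ -32 * (b ^ 3 - a ^ 3) := by
    intro hd
    have h' : (3 : ℤ) ∣ b ^ 3 := by omega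
    exact hnb (hP.dvd_of_dvd_pow h')
  refine ⟨?_, ?_, ?_⟩
  · rw [show -48 * (3 * a * b) = 3 ^ 2 * (-16 * (a * b)) by ring]
    exact padicVal_three_aux 2 _ hnab
  · rw [show -864 * (b ^ 3 - a ^ 3) = 3 ^ 3 * (-32 * (b ^ 3 - a ^ 3)) by ring]
    exact padicVal_three_aux 3 _ hnd
  · have hcp : (c ^ p) ^ 2 ≠ 0 := pow_ne_zero _ (pow_ne_zero _ hc)
    rw [show -16 * (4 * (3 * a * b) ^ 3 + 27 * (b ^ 3 - a ^ 3) ^ 2)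
      = (3 ^ 3 * (-16)) * (a ^ 3 + b ^ 3) ^ 2 by ring, h,
      padicValInt.mul (by norm_num) hcp, padicVal_three_aux 3 (-16) (by norm_num),
      ← pow_mul, padicVal_three_pow_aux c hc]
    ring
end

section
/- Let p ≥ 3 be a prime and let H₁, H₂ be subgroups of GL₂(𝔽_p) such that every element of H₁ and of H₂ has determinant 1 and both H₁ and H₂ are isomorphic (as groups) to SL₂(𝔽₃). Then H₁ and H₂ are conjugate in GL₂(𝔽_p), i.e. there exists g ∈ GL₂(𝔽_p) with g·H₁·g⁻¹ = H₂. -/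
namespace SL2F3

open Matrix

abbrev S := Matrix.SpecialLinearGroup (Fin 2) (ZMod 3)

def si : S := ⟨!![0, -1; 1, 0], by decide⟩
def sj : S := ⟨!![1, 1; 1, -1], by decide⟩
def sw : S := ⟨!![1, 1; 0, 1], by decide⟩
def sz : S := ⟨!![-1, 0; 0, -1], by decide⟩

lemma rel_ii : si * si = sz := by decide
lemma rel_jj : sj * sj = sz := by decide
lemma rel_ij : si * sj = sz * (sj * si) := by decide
lemma rel_wi : sw * si = sj * sw := by decide
lemma rel_wj : sw * sj = si * sj * sw := by decide
lemma rel_www : sw ^ 3 = 1 := by decide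
lemma rel_zz : sz * sz = 1 := by decide
lemma rel_z : sz ≠ 1 := by decide

set_option maxRecDepth 100000 in
lemma gen_aux : ∀ a b c d : ZMod 3, a * d - b * c = 1 → ∃ (k : Fin 4) (l : Fin 2) (m : Fin 3),
    !![a, b; c, d] = (si.1 ^ k.val * sj.1 ^ l.val * sw.1 ^ m.val) := by
  decide

lemma gen (s : S) : ∃ (k l m : ℕ), s = si ^ k * sj ^ l * sw ^ m := by
  have h := s.2
  rw [Matrix.det_fin_two] at h
  obtain ⟨k, l, m, e⟩ := gen_aux _ _ _ _ h
  refine ⟨k, l, m, Subtype.ext ?_⟩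
  rw [← Matrix.eta_fin_two] at e
  simpa using e

section mat
variable {F : Type*} [Field F]

lemma ch (M : Matrix (Fin 2) (Fin 2) F) : M * M = M.trace • M - M.det • 1 := by
  ext a b
  fin_cases a <;> fin_cases b <;>
    simp [Matrix.mul_apply, Fin.sum_univ_two, Matrix.trace_fin_two, Matrix.det_fin_two] <;> ring

lemma ch2 (M N : Matrix (Fin 2) (Fin 2) F) : M * N + N * M =
    M.trace • N + N.trace • M + ((M * N).trace - M.trace * N.trace) • 1 := by
  ext a b
  fin_cases a <;> fin_cases b <;>
    simp [Matrix.mul_apply, Fin.sum_univ_two, Matrix.trace_fin_two] <;> ring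

lemma neg_one_of (h2 : (2 : F) ≠ 0) (Z : Matrix (Fin 2) (Fin 2) F) (hZ : Z * Z = 1)
    (hd : Z.det = 1) (h1 : Z ≠ 1) : Z = -1 := by
  have h := ch Z
  rw [hZ, hd] at h
  have h3 : Z.trace • Z = (2 : F) • 1 := by
    rw [one_smul] at h
    rw [two_smul]; nth_rewrite 1 [h]; abel
  have ht : Z.trace ≠ 0 := by
    intro h0
    rw [h0, zero_smul] at h3
    have := congrFun (congrFun h3 0) 0
    simp at this
    exact h2 this.symm
  have h4 : Z = (Z.trace⁻¹ * 2) • (1 : Matrix (Fin 2) (Fin 2) F) := by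
    rw [mul_smul, ← h3, smul_smul, inv_mul_cancel₀ ht, one_smul]
  generalize Z.trace⁻¹ * 2 = c at h4
  subst h4
  have := congrFun (congrFun hZ 0) 0
  have hcc : c * c = 1 := by simpa using this
  rcases mul_self_eq_one_iff.1 hcc with rfl | rfl
  · simp at h1
  · simp

lemma trace_zero (M : Matrix (Fin 2) (Fin 2) F) (h : M * M = -1) (hd : M.det = 1) :
    M.trace = 0 := by
  have h' := ch M
  rw [h, hd, one_smul] at h'
  have h3 : M.trace • M = 0 := by
    have := congrArg (· + 1) h'
    simpa using this.symm
  rcases smul_eq_zero.1 h3 with h0 | h0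
  · exact h0
  · simp [h0]

lemma schur (h2 : (2 : F) ≠ 0) (I J U : Matrix (Fin 2) (Fin 2) F) (hI : I * I = -1)
    (hJ : J * J = -1)
    (tI : I.trace = 0) (tJ : J.trace = 0) (tK : (I * J).trace = 0) (cI : U * I = I * U)
    (cJ : U * J = J * U) : ∃ c : F, U = c • 1 := by
  have key : ∀ M : Matrix (Fin 2) (Fin 2) F, M * M = -1 → M.trace = 0 → U * M = M * U →
      (2 : F) • U = U.trace • 1 - (U * M).trace • M := by
    intro M hM tM cM
    have h := congrArg (· * M) (ch2 U M)
    simp only [← cM, tM, add_mul, mul_assoc, hM, smul_mul_assoc] at h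
    simp at h
    rw [two_smul]
    rw [← neg_inj, neg_add, neg_sub, sub_eq_add_neg, add_comm (_ • M)]
    first | exact h | (rw [← sub_eq_add_neg (-U) U]; exact h)
  have kI := key I hI tI cI
  have kJ := key J hJ tJ cJ
  rw [kI] at kJ
  have h5 : (U * I).trace • I = (U * J).trace • J := by simpa using kJ
  have h6 := congrArg (fun M => (I * M).trace) h5
  simp [hI, tK] at h6
  have h7 : (U * I).trace = 0 := by
    rcases h6 with h | h
    · exact h
    · exact absurd (by simpa [Matrix.trace_fin_two, one_add_one_eq_two] using h) h2
  refine ⟨2⁻¹ * U.trace, ?_⟩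
  rw [h7, zero_smul, sub_zero] at kI
  rw [mul_smul, ← kI, smul_smul, inv_mul_cancel₀ h2, one_smul]

lemma line (r v w : Fin 2 → F) (hr : r ≠ 0) (hv : v ≠ 0) (h1 : r ⬝ᵥ v = 0) (h2 : r ⬝ᵥ w = 0) :
    ∃ a : F, w = a • v := by
  simp only [dotProduct, Fin.sum_univ_two] at h1 h2
  have hd : v 0 * w 1 = v 1 * w 0 := by
    by_contra hne
    apply hr
    have hne' : v 0 * w 1 - v 1 * w 0 ≠ 0 := sub_ne_zero.2 hne
    ext k
    fin_cases k
    · have : r 0 * (v 0 * w 1 - v 1 * w 0) = 0 := by linear_combination w 1 * h1 - v 1 * h2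
      simpa [hne'] using this
    · have : r 1 * (v 0 * w 1 - v 1 * w 0) = 0 := by linear_combination v 0 * h2 - w 0 * h1
      simpa [hne'] using this
  by_cases h0 : v 0 = 0
  · have hv1 : v 1 ≠ 0 := by
      intro h
      apply hv
      ext k
      fin_cases k <;> simp [h0, h]
    refine ⟨w 1 / v 1, ?_⟩
    ext k
    fin_cases k
    · simp [h0, hv1] at hd ⊢
      exact hd
    · simp; field_simp
  · refine ⟨w 0 / v 0, ?_⟩
    ext k
    fin_cases k
    · simp; field_simp
    · simp; field_simp; linear_combination hd

lemma det_ne (h2 : (2 : F) ≠ 0) (I J I' J' g : Matrix (Fin 2) (Fin 2) F) (hI : I * I = -1)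
    (hJ : J * J = -1) (hIJ : I * J = -(J * I)) (gI : I' * g = g * I) (gJ : J' * g = g * J)
    (hg : g ≠ 0) : g.det ≠ 0 := by
  intro hd
  obtain ⟨v, hv, hgv⟩ := Matrix.exists_mulVec_eq_zero_iff.2 hd
  obtain ⟨k, hk⟩ : ∃ k, g k ≠ 0 := by
    by_contra! h
    exact hg (funext h)
  have e0 : g k ⬝ᵥ v = 0 := congrFun hgv k
  have e1 : g k ⬝ᵥ (I *ᵥ v) = 0 := by
    have : g *ᵥ (I *ᵥ v) = 0 := by
      rw [Matrix.mulVec_mulVec, ← gI, ← Matrix.mulVec_mulVec, hgv, Matrix.mulVec_zero]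
    exact congrFun this k
  have e2 : g k ⬝ᵥ (J *ᵥ v) = 0 := by
    have : g *ᵥ (J *ᵥ v) = 0 := by
      rw [Matrix.mulVec_mulVec, ← gJ, ← Matrix.mulVec_mulVec, hgv, Matrix.mulVec_zero]
    exact congrFun this k
  obtain ⟨a, ha⟩ := line _ _ _ hk hv e0 e1
  obtain ⟨b, hb⟩ := line _ _ _ hk hv e0 e2
  have f1 : (a * a) • v = (-1 : F) • v := by
    have := congrArg (· *ᵥ v) hI
    simp only [← Matrix.mulVec_mulVec, ha, Matrix.mulVec_smul, smul_smul, Matrix.neg_mulVec,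
      Matrix.one_mulVec] at this
    rw [this]; simp
  have f2 : (b * b) • v = (-1 : F) • v := by
    have := congrArg (· *ᵥ v) hJ
    simp only [← Matrix.mulVec_mulVec, hb, Matrix.mulVec_smul, smul_smul, Matrix.neg_mulVec,
      Matrix.one_mulVec] at this
    rw [this]; simp
  have f3 : (b * a) • v = (-(a * b)) • v := by
    have := congrArg (· *ᵥ v) hIJ
    simp only [← Matrix.mulVec_mulVec, ha, hb, Matrix.mulVec_smul, smul_smul, Matrix.neg_mulVec,
      Matrix.one_mulVec] at this
    rw [this, neg_smul]
  have g1 := smul_left_injective F hv f1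
  have g2 := smul_left_injective F hv f2
  have g3 := smul_left_injective F hv f3
  apply h2
  linear_combination (a * b) * g3 - (2 * b * b) * g1 + 2 * g2

lemma inter (h2 : (2 : F) ≠ 0) (I J I' J' : Matrix (Fin 2) (Fin 2) F) (hI : I * I = -1)
    (hJ : J * J = -1) (hIJ : I * J = -(J * I)) (hI' : I' * I' = -1)
    (hJ' : J' * J' = -1) (hIJ' : I' * J' = -(J' * I'))
    (tI : I.trace = 0) (tJ : J.trace = 0) (tK : (I * J).trace = 0) :
    ∃ g : Matrix (Fin 2) (Fin 2) F, g.det ≠ 0 ∧ I' * g = g * I ∧ J' * g = g * J := by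
  have hJI : J * I = -(I * J) := by rw [hIJ, neg_neg]
  have hJI' : J' * I' = -(I' * J') := by rw [hIJ', neg_neg]
  let T : Matrix (Fin 2) (Fin 2) F → Matrix (Fin 2) (Fin 2) F := fun X =>
    X - I' * X * I - J' * X * J - I' * J' * X * (I * J)
  have cI : ∀ X, I' * T X = T X * I := by
    intro X
    have a1 : I' * (I' * X * I) = - (X * I) := by
      rw [mul_assoc, ← mul_assoc, hI']; simp
    have a2 : I' * (J' * X * J) = I' * J' * X * J := by simp only [mul_assoc]
    have a3 : I' * (I' * J' * X * (I * J)) = -(J' * X * (I * J)) := by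
      simp only [← mul_assoc, hI']; simp
    have b1 : I' * X * I * I = -(I' * X) := by rw [mul_assoc, hI]; simp
    have b2 : J' * X * J * I = -(J' * X * (I * J)) := by rw [mul_assoc, hJI]; simp
    have b3 : I' * J' * X * (I * J) * I = I' * J' * X * J := by
      rw [mul_assoc, mul_assoc I J I, hJI, mul_neg, ← mul_assoc I I J, hI]; simp
    simp only [T, mul_sub, sub_mul, a1, a2, a3, b1, b2, b3]
    abel
  have cJ : ∀ X, J' * T X = T X * J := by
    intro X
    have a1 : J' * (J' * X * J) = - (X * J) := by
      rw [mul_assoc, ← mul_assoc, hJ']; simp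
    have a2 : J' * (I' * X * I) = -(I' * J' * X * I) := by
      simp only [← mul_assoc, hJI']; simp
    have a3 : J' * (I' * J' * X * (I * J)) = I' * X * (I * J) := by
      have : J' * (I' * J') = I' := by rw [hIJ', mul_neg, ← mul_assoc, hJ']; simp
      simp only [← mul_assoc] at this ⊢
      rw [this]
    have b1 : J' * X * J * J = -(J' * X) := by rw [mul_assoc, hJ]; simp
    have b2 : I' * X * I * J = I' * X * (I * J) := by rw [mul_assoc]
    have b3 : I' * J' * X * (I * J) * J = -(I' * J' * X * I) := by
      rw [mul_assoc, mul_assoc I J J, hJ]; simp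
    simp only [T, mul_sub, sub_mul, a1, a2, a3, b1, b2, b3]
    abel
  obtain ⟨X, hX⟩ : ∃ X, T X ≠ 0 := by
    by_contra! h
    have tot : ∑ a, ∑ b, T (Matrix.single a b 1) a b =
        4 - I'.trace * I.trace - J'.trace * J.trace - (I' * J').trace * (I * J).trace := by
      generalize hK : I * J = K at *
      generalize hK' : I' * J' = K' at *
      simp [T, hK, hK', Fin.sum_univ_two, Matrix.trace_fin_two, Matrix.mul_apply, Matrix.single]
      ring
    simp [h, tI, tJ, tK] at tot
    apply h2
    have : (2 : F) * 2 = 0 := by linear_combination -tot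
    simpa using this
  exact ⟨T X, det_ne h2 I J I' J' _ hI hJ hIJ (cI X) (cJ X) hX, cI X, cJ X⟩

lemma hom_facts (h2 : (2 : F) ≠ 0) (f : S →* GL (Fin 2) F) (hf : Function.Injective f)
    (hd : ∀ s, (f s).val.det = 1) :
    (f si).val * (f si).val = -1 ∧ (f sj).val * (f sj).val = -1 ∧
    (f si).val * (f sj).val = -((f sj).val * (f si).val) ∧
    (f si).val.trace = 0 ∧ (f sj).val.trace = 0 ∧ ((f si).val * (f sj).val).trace = 0 := by
  have m : ∀ s t, (f s).val * (f t).val = (f (s * t)).val := by intro s t; simp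
  have hz : (f sz).val = -1 := by
    apply neg_one_of h2 _ _ (hd _)
    · intro h
      exact rel_z (hf (by rw [map_one]; exact Units.ext h))
    · rw [m, rel_zz]; simp
  have hi : (f si).val * (f si).val = -1 := by rw [m, rel_ii, hz]
  have hj : (f sj).val * (f sj).val = -1 := by rw [m, rel_jj, hz]
  have hk : (f (si * sj)).val * (f (si * sj)).val = -1 := by
    rw [m, show si * sj * (si * sj) = sz by decide, hz]
  refine ⟨hi, hj, ?_, trace_zero _ hi (hd _), trace_zero _ hj (hd _), ?_⟩
  · rw [m, rel_ij, ← m, hz, ← m]; simp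
  · rw [m]; exact trace_zero _ hk (hd _)

lemma hom_conj (h2 : (2 : F) ≠ 0) (f f' : S →* GL (Fin 2) F) (hf : Function.Injective f)
    (hf' : Function.Injective f') (hd : ∀ s, (f s).val.det = 1) (hd' : ∀ s, (f' s).val.det = 1) :
    ∃ g : GL (Fin 2) F, ∀ s, g * f s * g⁻¹ = f' s := by
  obtain ⟨hI, hJ, hIJ, tI, tJ, tK⟩ := hom_facts h2 f hf hd
  obtain ⟨hI', hJ', hIJ', tI', tJ', tK'⟩ := hom_facts h2 f' hf' hd'
  obtain ⟨g0, hg0, cI, cJ⟩ := inter h2 _ _ _ _ hI hJ hIJ hI' hJ' hIJ' tI tJ tK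
  let g : GL (Fin 2) F := Matrix.GeneralLinearGroup.mkOfDetNeZero g0 hg0
  have gI : g * f si * g⁻¹ = f' si := by
    rw [mul_inv_eq_iff_eq_mul]; exact Units.ext cI.symm
  have gJ : g * f sj * g⁻¹ = f' sj := by
    rw [mul_inv_eq_iff_eq_mul]; exact Units.ext cJ.symm
  let q : S →* GL (Fin 2) F := (MulAut.conj g).toMonoidHom.comp f
  have qd : ∀ s, q s = g * f s * g⁻¹ := fun s => rfl
  have qI : q si = f' si := gI
  have qJ : q sj = f' sj := gJ
  have q1 : q sw * f' si = f' sj * q sw := by rw [← qI, ← qJ, ← map_mul, ← map_mul, rel_wi]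
  have q2 : q sw * f' sj = f' si * f' sj * q sw := by
    rw [← qI, ← qJ, ← map_mul, ← map_mul, ← map_mul, rel_wj]
  have r1 : f' sw * f' si = f' sj * f' sw := by rw [← map_mul, ← map_mul, rel_wi]
  have r2 : f' sw * f' sj = f' si * f' sj * f' sw := by
    rw [← map_mul, ← map_mul, ← map_mul, rel_wj]
  obtain ⟨U, hU⟩ : ∃ U, U = (f' sw)⁻¹ * q sw := ⟨_, rfl⟩
  have hqU : q sw = f' sw * U := by rw [hU]; group
  have u1 : U * f' si = f' si * U := by
    apply mul_left_cancel (a := f' sw)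
    rw [← mul_assoc, ← hqU, q1, ← mul_assoc, r1, mul_assoc, hqU]
  have u2 : U * f' sj = f' sj * U := by
    apply mul_left_cancel (a := f' sw)
    rw [← mul_assoc, ← hqU, q2, ← mul_assoc, r2, mul_assoc _ (f' sw), hqU]
  obtain ⟨c, hc⟩ := schur h2 _ _ U.val hI' hJ' tI' tJ' tK' (congrArg Units.val u1)
    (congrArg Units.val u2)
  have hdq : (q sw).val.det = 1 := by
    have := congrArg (fun x => (Matrix.GeneralLinearGroup.det x)) (qd sw)
    simp only [map_mul, map_inv] at this
    rw [mul_right_comm, mul_inv_cancel, one_mul] at this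
    have := congrArg Units.val this
    simpa [hd] using this
  have hcd : c * c = 1 := by
    have h := congrArg (fun x => x.val.det) hqU
    simp only [Units.val_mul, Matrix.det_mul, hdq, hd', one_mul, hc] at h
    simp [Matrix.det_smul] at h
    rw [← pow_two]; exact h.symm
  have hU2 : U ^ 2 = 1 := by
    apply Units.ext
    rw [pow_two, Units.val_mul, hc]
    simp [smul_smul, hcd]
  have hcomm : Commute (f' sw) U := by
    apply Units.ext
    rw [Units.val_mul, Units.val_mul, hc]; simp
  have hU3 : U ^ 3 = 1 := by
    have h := congrArg (· ^ 3) hqU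
    simp only [hcomm.mul_pow, ← map_pow, rel_www, map_one, one_mul] at h
    exact h.symm
  have hU1 : U = 1 := by
    rw [pow_succ, hU2, one_mul] at hU3; exact hU3
  have qW : q sw = f' sw := by rw [hqU, hU1, mul_one]
  refine ⟨g, fun s => ?_⟩
  rw [← qd]
  obtain ⟨k, l, m, rfl⟩ := gen s
  simp only [map_mul, map_pow, qI, qJ, qW]

end mat

end SL2F3


/-- Any two subgroups of `GL₂(𝔽_p)` (for `p ≥ 3` prime) contained in `SL₂(𝔽_p)` and
abstractly isomorphic to `SL₂(𝔽₃)` are conjugate in `GL₂(𝔽_p)`. -/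
theorem sl2_f3_subgroups_conjugate
    (p : ℕ) (hp : p.Prime) (hp3 : 3 ≤ p)
    (H₁ H₂ : Subgroup (Matrix.GeneralLinearGroup (Fin 2) (ZMod p)))
    (hdet₁ : ∀ M ∈ H₁, Matrix.GeneralLinearGroup.det M = 1)
    (hdet₂ : ∀ M ∈ H₂, Matrix.GeneralLinearGroup.det M = 1)
    (hiso₁ : Nonempty (H₁ ≃* Matrix.SpecialLinearGroup (Fin 2) (ZMod 3)))
    (hiso₂ : Nonempty (H₂ ≃* Matrix.SpecialLinearGroup (Fin 2) (ZMod 3))) :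
    ∃ g : Matrix.GeneralLinearGroup (Fin 2) (ZMod p),
      Subgroup.map (MulAut.conj g).toMonoidHom H₁ = H₂ := by
  haveI := Fact.mk hp
  have h2 : (2 : ZMod p) ≠ 0 := by
    intro h
    have h' : ((2 : ℕ) : ZMod p) = 0 := by exact_mod_cast h
    rw [ZMod.natCast_eq_zero_iff] at h'
    have := Nat.le_of_dvd (by norm_num) h'
    omega
  obtain ⟨e₁⟩ := hiso₁
  obtain ⟨e₂⟩ := hiso₂
  obtain ⟨g, hg⟩ := SL2F3.hom_conj h2 (H₁.subtype.comp e₁.symm.toMonoidHom)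
    (H₂.subtype.comp e₂.symm.toMonoidHom)
    (H₁.subtype_injective.comp e₁.symm.injective) (H₂.subtype_injective.comp e₂.symm.injective)
    (fun s => congrArg Units.val (hdet₁ _ (e₁.symm s).2))
    (fun s => congrArg Units.val (hdet₂ _ (e₂.symm s).2))
  refine ⟨g, ?_⟩
  ext x
  constructor
  · rintro ⟨y, hy, rfl⟩
    have := hg (e₁ ⟨y, hy⟩)
    simp at this
    simp only [MulEquiv.toMonoidHom_eq_coe, MonoidHom.coe_coe, MulAut.conj_apply]
    rw [this]
    exact SetLike.coe_mem _
  · intro hx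
    have := hg (e₂ ⟨x, hx⟩)
    simp at this
    exact ⟨_, SetLike.coe_mem (e₁.symm (e₂ ⟨x, hx⟩)), this⟩
end
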